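/- arXiv:2006.06465 — 3 statements merged into one kernel-verified Lean document; each statement's English description precedes it below -/
import Mathlib

section
/- Let C be a class of functions X → {0,1} with VC-dimension d ≥ 1, and for k ≥ 1 let D_k(C) = { h : X → {0,1} | h(x) = max(c_1(x), …, c_k(x)) for some c_1, …, c_k ∈ C } be the class of pointwise disjunctions (k-fold unions) of k hypotheses from C. Then the VC-dimension of D_k(C) is at most 2dk·log₂(3k). -/
/-- A class `H` of `{0,1}`-valued functions shatters a finite set `S` if every
labelling of `S` is realized by the restriction of some `h ∈ H` to `S`. -/
def Shatters {X : Type*} (H : Set (X → Bool)) (S : Finset X) : Prop :=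
  ∀ g : X → Bool, ∃ h ∈ H, ∀ x ∈ S, h x = g x

/-- `D_k(C)`: the class of pointwise disjunctions (`k`-fold unions) of `k`
hypotheses from `C`, i.e. `h(x) = max(c₁(x), …, c_k(x))` with each `cⱼ ∈ C`. -/
def DisjunctionsOf {X : Type*} (k : ℕ) (C : Set (X → Bool)) : Set (X → Bool) :=
  {h | ∃ c : Fin k → (X → Bool), (∀ j, c j ∈ C) ∧
    ∀ x : X, h x = decide (∃ j, c j x = true)}

/-- The traces on `S` of the hypotheses in `C`, as a finite set family. -/
noncomputable def traces {X : Type*} (C : Set (X → Bool)) (S : Finset X) : Finset (Finset X) := by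
  classical exact S.powerset.filter fun t => ∃ c ∈ C, t = S.filter fun x => c x = true

lemma mem_traces {X : Type*} {C : Set (X → Bool)} {S t : Finset X} :
    t ∈ traces C S ↔ ∃ c ∈ C, t = S.filter fun x => c x = true := by
  classical
  simp only [traces, Finset.mem_filter, Finset.mem_powerset, and_iff_right_iff_imp]
  rintro ⟨c, -, rfl⟩
  exact Finset.filter_subset _ _

/-- The **Sauer-Shelah lemma** for the traces of a class of functions. -/
lemma card_traces_le {X : Type*} {C : Set (X → Bool)} {d : ℕ}
    (hub : ∀ S : Finset X, Shatters C S → S.card ≤ d) (S : Finset X) :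
    (traces C S).card ≤ ∑ i ∈ Finset.range (d + 1), S.card.choose i := by
  classical
  have hsub : (traces C S).shatterer ⊆
      (Finset.range (d + 1)).biUnion fun i => S.powersetCard i := by
    intro T hT
    rw [Finset.mem_shatterer] at hT
    have hTS : T ⊆ S := by
      obtain ⟨t, ht, hTt⟩ := hT.exists_superset
      obtain ⟨c, -, rfl⟩ := mem_traces.1 ht
      exact hTt.trans (Finset.filter_subset _ _)
    have hcard : T.card ≤ d := by
      refine hub T fun g => ?_
      obtain ⟨t, ht, hTt⟩ := hT (Finset.filter_subset (fun x => g x = true) T)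
      obtain ⟨c, hc, rfl⟩ := mem_traces.1 ht
      refine ⟨c, hc, fun x hx => ?_⟩
      have h := congrArg (fun s => x ∈ s) hTt
      simp only [Finset.mem_inter, Finset.mem_filter, hx, hTS hx, true_and, eq_iff_iff] at h
      exact Bool.eq_iff_iff.2 h
    simp only [Finset.mem_biUnion, Finset.mem_range, Finset.mem_powersetCard]
    exact ⟨T.card, by omega, hTS, rfl⟩
  calc (traces C S).card ≤ (traces C S).shatterer.card := Finset.card_le_card_shatterer _
    _ ≤ _ := Finset.card_le_card hsub
    _ ≤ _ := Finset.card_biUnion_le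
    _ = _ := by simp only [Finset.card_powersetCard]

lemma two_pow_card_le_card_traces_pow {X : Type*} {C : Set (X → Bool)} {k : ℕ} {S : Finset X}
    (hS : Shatters (DisjunctionsOf k C) S) : 2 ^ S.card ≤ (traces C S).card ^ k := by
  classical
  have hsub : S.powerset ⊆ (Fintype.piFinset fun _ : Fin k => traces C S).image
      fun f => Finset.univ.biUnion f := by
    intro T hT
    rw [Finset.mem_powerset] at hT
    obtain ⟨h, ⟨c, hc, hh⟩, hg⟩ := hS fun x => decide (x ∈ T)
    refine Finset.mem_image.2 ⟨fun j => S.filter fun x => c j x = true, ?_, ?_⟩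
    · exact Fintype.mem_piFinset.2 fun j => mem_traces.2 ⟨c j, hc j, rfl⟩
    · ext x
      simp only [Finset.mem_biUnion, Finset.mem_univ, true_and, Finset.mem_filter]
      constructor
      · rintro ⟨j, hxS, hj⟩
        have h1 := hg x hxS
        rw [hh x, decide_eq_decide] at h1
        exact h1.1 ⟨j, hj⟩
      · intro hx
        have h1 := hg x (hT hx)
        rw [hh x, decide_eq_decide] at h1
        obtain ⟨j, hj⟩ := h1.2 hx
        exact ⟨j, hT hx, hj⟩
  calc 2 ^ S.card = S.powerset.card := (Finset.card_powerset S).symm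
    _ ≤ _ := Finset.card_le_card hsub
    _ ≤ _ := Finset.card_image_le
    _ = _ := by simp

lemma sum_range_choose_le_exp_mul_div_pow {m d : ℕ} (hd : 1 ≤ d) (hdm : d ≤ m) :
    ((∑ i ∈ Finset.range (d + 1), m.choose i : ℕ) : ℝ) ≤ (Real.exp 1 * (m / d)) ^ d := by
  have hd0 : (0 : ℝ) < d := by exact_mod_cast hd
  have hdm' : (d : ℝ) ≤ m := by exact_mod_cast hdm
  have hm0 : (0 : ℝ) < m := hd0.trans_le hdm'
  have hr0 : (0 : ℝ) < d / m := by positivity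
  have hr1 : (d : ℝ) / m ≤ 1 := (div_le_one hm0).2 hdm'
  have key : ((d : ℝ) / m) ^ d * ((∑ i ∈ Finset.range (d + 1), m.choose i : ℕ) : ℝ)
      ≤ Real.exp 1 ^ d := by
    push_cast
    calc ((d : ℝ) / m) ^ d * ∑ i ∈ Finset.range (d + 1), (m.choose i : ℝ)
        ≤ ∑ i ∈ Finset.range (d + 1), ((d : ℝ) / m) ^ i * (m.choose i : ℝ) := by
          rw [Finset.mul_sum]
          refine Finset.sum_le_sum fun i hi => ?_
          have := pow_le_pow_of_le_one hr0.le hr1 (Finset.mem_range_succ_iff.1 hi)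
          gcongr
      _ ≤ ∑ i ∈ Finset.range (m + 1), ((d : ℝ) / m) ^ i * (m.choose i : ℝ) :=
          Finset.sum_le_sum_of_subset_of_nonneg (Finset.range_mono (by omega))
            fun i _ _ => by positivity
      _ = ((d : ℝ) / m + 1) ^ m := by simp [add_pow]
      _ ≤ Real.exp (d / m) ^ m := by
          gcongr
          exact Real.add_one_le_exp _
      _ = Real.exp 1 ^ d := by
          rw [← Real.exp_nat_mul, ← Real.exp_nat_mul, mul_div_cancel₀ _ hm0.ne', mul_one]
  have hinv : (m : ℝ) / d = (d / m : ℝ)⁻¹ := (inv_div _ _).symm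
  rw [hinv, mul_pow, inv_pow, ← div_eq_mul_inv, le_div_iff₀ (by positivity), mul_comm]
  exact key

lemma log_three_le : Real.log 3 ≤ 8 / 5 * Real.log 2 := by
  have h : Real.log ((3 : ℝ) ^ 5) ≤ Real.log ((2 : ℝ) ^ 8) :=
    Real.log_le_log (by norm_num) (by norm_num)
  rw [Real.log_pow, Real.log_pow] at h
  push_cast at h
  linarith

lemma two_mul_exp_one_mul_log_le {k : ℝ} (hk : 1 ≤ k) :
    2 * Real.exp 1 * Real.log (3 * k) ≤ 9 * k * Real.log 2 := by
  have he := Real.exp_one_lt_d9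
  have he0 := Real.exp_pos 1
  have h2 := Real.log_two_gt_d9
  have hL : Real.log (3 * k) ≤ 8 / 5 * Real.log 2 + (k - 1) := by
    rw [Real.log_mul (by norm_num) (by positivity)]
    linarith [log_three_le, Real.log_le_sub_one_of_pos (by linarith : 0 < k)]
  calc 2 * Real.exp 1 * Real.log (3 * k)
      ≤ 2 * Real.exp 1 * (8 / 5 * Real.log 2 + (k - 1)) := by gcongr
    _ ≤ 5.44 * (8 / 5 * Real.log 2 + (k - 1)) := by
        have : 0 ≤ 8 / 5 * Real.log 2 + (k - 1) := by linarith
        gcongr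
        linarith
    _ ≤ 9 * k * Real.log 2 := by nlinarith

lemma one_lt_log_three : 1 < Real.log 3 := by
  rw [Real.lt_log_iff_exp_lt (by norm_num)]
  linarith [Real.exp_one_lt_d9]

lemma le_of_mul_log_two_le {k x : ℝ} (hk : 1 ≤ k) (hx : 0 < x)
    (h : x * Real.log 2 ≤ k * (1 + Real.log x)) :
    x ≤ 2 * k * Real.logb 2 (3 * k) := by
  by_contra! hlt
  have h2 : 0 < Real.log 2 := Real.log_pos one_lt_two
  have hk0 : 0 < k := by linarith
  have hL : 1 < Real.log (3 * k) :=
    one_lt_log_three.trans_le (Real.log_le_log (by norm_num) (by linarith))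
  set L := Real.log (3 * k) with hLdef
  set y := 2 * k * Real.logb 2 (3 * k) with hy
  have hyL : y * Real.log 2 = 2 * k * L := by
    rw [hy, Real.logb, ← hLdef]
    field_simp
  have hy0 : 0 < y := by
    have : 0 < 2 * k * L := by positivity
    rw [← hyL] at this
    exact pos_of_mul_pos_left this h2.le
  have hlogx : Real.log x ≤ Real.log y + (x / y - 1) := by
    have := Real.log_le_sub_one_of_pos (div_pos hx hy0)
    rw [Real.log_div hx.ne' hy0.ne'] at this
    linarith
  have hlogy : 2 * L - 1 < Real.log y := by
    have hr : 1 < x / y := (one_lt_div hy0).2 hlt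
    have hxr : x * Real.log 2 = k * (2 * L * (x / y)) := by
      calc x * Real.log 2 = x / y * (y * Real.log 2) := by field_simp
        _ = _ := by rw [hyL]; ring
    rw [hxr] at h
    have := le_of_mul_le_mul_left h hk0
    nlinarith
  have hlt' : Real.exp (2 * L - 1) < y := (Real.lt_log_iff_exp_lt hy0).1 hlogy
  have hexp : Real.exp (2 * L - 1) = (3 * k) ^ 2 / Real.exp 1 := by
    rw [Real.exp_sub, two_mul, Real.exp_add, hLdef, Real.exp_log (by positivity), sq]
  rw [hexp, div_lt_iff₀ (Real.exp_pos 1)] at hlt'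
  have hmul := mul_lt_mul_of_pos_right hlt' h2
  have hnum := mul_le_mul_of_nonneg_left (two_mul_exp_one_mul_log_le hk) hk0.le
  have : y * Real.exp 1 * Real.log 2 = k * (2 * Real.exp 1 * L) := by
    rw [mul_right_comm, hyL]; ring
  rw [this] at hmul
  nlinarith

/-- If `C` is a class with VC-dimension `d ≥ 1`, then for `k ≥ 1` the VC-dimension
of the class `D_k(C)` of `k`-fold unions of hypotheses from `C` is at most
`2dk·log₂(3k)`: every set shattered by `D_k(C)` has cardinality at most this bound. -/
theorem vcDim_kfold_union_le {X : Type*} (C : Set (X → Bool)) (d k : ℕ)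
    (hd : 1 ≤ d) (hk : 1 ≤ k)
    (hub : ∀ S : Finset X, Shatters C S → S.card ≤ d)
    (hlb : ∃ S : Finset X, Shatters C S ∧ S.card = d) :
    ∀ S : Finset X, Shatters (DisjunctionsOf k C) S →
      (S.card : ℝ) ≤ 2 * (d : ℝ) * (k : ℝ) * Real.logb 2 (3 * (k : ℝ)) := by
  intro S hS
  have hd0 : (0 : ℝ) < d := by exact_mod_cast hd
  have hk1 : (1 : ℝ) ≤ k := by exact_mod_cast hk
  rcases le_total S.card d with hm | hm
  · have hm' : (S.card : ℝ) ≤ d := by exact_mod_cast hm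
    have hlog : 1 ≤ Real.logb 2 (3 * (k : ℝ)) := by
      rw [Real.le_logb_iff_rpow_le one_lt_two (by positivity), Real.rpow_one]
      linarith
    calc (S.card : ℝ) ≤ d * (1 * 1) := by linarith
      _ ≤ d * (2 * k * Real.logb 2 (3 * (k : ℝ))) := by
          gcongr
          linarith
      _ = _ := by ring
  · have hm0 : (0 : ℝ) < S.card := by exact_mod_cast hd.trans hm
    have hpow : (2 : ℝ) ^ S.card ≤ ((Real.exp 1 * (S.card / d)) ^ d) ^ k := by
      calc (2 : ℝ) ^ S.card ≤ ((traces C S).card : ℝ) ^ k := by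
            exact_mod_cast two_pow_card_le_card_traces_pow hS
        _ ≤ ((Real.exp 1 * (S.card / d)) ^ d) ^ k := by
            gcongr
            exact (Nat.cast_le.2 (card_traces_le hub S)).trans
              (sum_range_choose_le_exp_mul_div_pow hd hm)
    have hx : (0 : ℝ) < S.card / d := by positivity
    have hlog := Real.log_le_log (by positivity) hpow
    rw [Real.log_pow, Real.log_pow, Real.log_pow, Real.log_mul (Real.exp_pos 1).ne' hx.ne',
      Real.log_exp] at hlog
    have hle := le_of_mul_log_two_le hk1 hx (by
      rw [div_mul_eq_mul_div, div_le_iff₀ hd0]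
      linarith)
    rw [div_le_iff₀ hd0] at hle
    linarith
end

section
/- Let DT_n^r denote the class of Boolean functions {0,1}^n → {0,1} computable by a decision tree over n Boolean variables of rank at most r, where along each root-to-leaf path each variable is queried at most once. Then the VC-dimension of DT_n^r equals ∑_{i=0}^r binomial(n, i). -/
/-- A decision tree over `n` Boolean variables: a finite binary tree whose internal
nodes are labeled by variables and whose leaves are labeled `0` or `1`. -/
inductive DTree (n : ℕ) where
  | leaf (b : Bool)
  | node (i : Fin n) (l r : DTree n)

/-- Evaluation of a decision tree: at a node labeled `xᵢ`, go to the left child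
if `x i = false` (i.e. `0`) and to the right child if `x i = true` (i.e. `1`). -/
def DTree.eval {n : ℕ} : DTree n → (Fin n → Bool) → Bool
  | .leaf b, _ => b
  | .node i l r, x => if x i then r.eval x else l.eval x

/-- The rank of a (decision) tree: a single node has rank `0`; a tree with subtrees of
ranks `r₀, r₁` has rank `r₀ + 1` if `r₀ = r₁` and rank `max r₀ r₁` otherwise. -/
def DTree.rank {n : ℕ} : DTree n → ℕ
  | .leaf _ => 0
  | .node _ l r => if l.rank = r.rank then l.rank + 1 else max l.rank r.rank

/-- The set of variables appearing in a decision tree. -/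
def DTree.vars {n : ℕ} : DTree n → Finset (Fin n)
  | .leaf _ => ∅
  | .node i l r => insert i (l.vars ∪ r.vars)

/-- Along every root-to-leaf path, each variable is queried at most once. -/
def DTree.ReadOnce {n : ℕ} : DTree n → Prop
  | .leaf _ => True
  | .node i l r => i ∉ l.vars ∧ i ∉ r.vars ∧ l.ReadOnce ∧ r.ReadOnce

/-- The subsets of `Fin n` with at most `r` elements. -/
def smallSubsets (n r : ℕ) : Finset (Finset (Fin n)) :=
  Finset.univ.filter fun A => A.card ≤ r

theorem mem_smallSubsets {n r : ℕ} {A : Finset (Fin n)} :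
    A ∈ smallSubsets n r ↔ A.card ≤ r := by
  simp [smallSubsets]

theorem card_smallSubsets (n r : ℕ) :
    (smallSubsets n r).card = ∑ i ∈ Finset.range (r + 1), n.choose i := by
  rw [Finset.card_eq_sum_card_fiberwise (f := Finset.card) (t := Finset.range (r + 1))]
  · refine Finset.sum_congr rfl fun i hi => ?_
    have h : (smallSubsets n r).filter (fun A => A.card = i) =
        Finset.powersetCard i Finset.univ := by
      ext A
      have := Finset.mem_range.mp hi
      simp only [Finset.mem_filter, mem_smallSubsets, Finset.mem_powersetCard_univ]
      omega
    rw [h, Finset.card_powersetCard, Finset.card_univ, Fintype.card_fin]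
  · intro A hA
    have := mem_smallSubsets.mp (Finset.mem_coe.mp hA)
    simp only [Finset.coe_range, Set.mem_Iio]
    omega

/-- Every function agrees, on the points of a subcube with at most `r` ones among the free
coordinates `V`, with a read-once decision tree over `V` of rank at most `r`. -/
theorem DTree.exists_eval_eq_of_card_le {n : ℕ} (g : (Fin n → Bool) → Bool)
    (V : Finset (Fin n)) (r : ℕ) (z : Fin n → Bool) :
    ∃ T : DTree n, T.vars ⊆ V ∧ T.ReadOnce ∧ T.rank ≤ r ∧
      ∀ x : Fin n → Bool, (∀ i ∉ V, x i = z i) → (V.filter fun i => x i = true).card ≤ r →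
        T.eval x = g x := by
  induction V using Finset.induction_on generalizing r z with
  | empty =>
    refine ⟨.leaf (g z), by simp [vars], trivial, Nat.zero_le _, fun x hx _ => ?_⟩
    rw [funext fun i => hx i (by simp)]
    rfl
  | insert i V hi ih =>
    cases r with
    | zero =>
      refine ⟨.leaf (g fun j => if j ∈ insert i V then false else z j), by simp [vars], trivial,
        le_rfl, fun x hx hc => ?_⟩
      rw [Nat.le_zero, Finset.card_eq_zero, Finset.filter_eq_empty_iff] at hc
      have hxz : x = fun j => if j ∈ insert i V then false else z j := by
        funext j
        by_cases hj : j ∈ insert i V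
        · simpa [hj] using hc hj
        · simpa [hj] using hx j hj
      rw [← hxz]
      rfl
    | succ r =>
      obtain ⟨T₀, hv₀, ho₀, hr₀, he₀⟩ := ih (r + 1) (Function.update z i false)
      obtain ⟨T₁, hv₁, ho₁, hr₁, he₁⟩ := ih r (Function.update z i true)
      have agree (x : Fin n → Bool) (hx : ∀ j ∉ insert i V, x j = z j) :
          ∀ j ∉ V, x j = Function.update z i (x i) j := by
        intro j hj
        by_cases hji : j = i
        · subst hji; simp
        · simpa [hji] using hx j (by simp [hji, hj])
      refine ⟨.node i T₀ T₁, ?_, ⟨fun h => hi (hv₀ h), fun h => hi (hv₁ h), ho₀, ho₁⟩, ?_,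
        fun x hx hc => ?_⟩
      · exact Finset.insert_subset_insert i (Finset.union_subset hv₀ hv₁)
      · simp only [rank]
        split_ifs <;> omega
      · have hxi := agree x hx
        rw [Finset.filter_insert] at hc
        cases h : x i with
        | false =>
          rw [h] at hxi
          simp only [h, Bool.false_eq_true, if_false] at hc
          simpa [eval, h] using he₀ x hxi hc
        | true =>
          rw [h] at hxi
          rw [if_pos h, Finset.card_insert_of_notMem (by simp [hi])] at hc
          simpa [eval, h] using he₁ x hxi (by omega)

/-- The monomial `∏ i ∈ A, x i` as a real function on the Boolean cube. -/
def cubeMonomial {n : ℕ} (A : Finset (Fin n)) (x : Fin n → Bool) : ℝ :=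
  ∏ i ∈ A, if x i then 1 else 0

/-- The real functions on the Boolean cube given by polynomials of degree at most `r`. -/
def cubePolynomials (n r : ℕ) : Submodule ℝ ((Fin n → Bool) → ℝ) :=
  Submodule.span ℝ (cubeMonomial '' {A | A.card ≤ r})

theorem cubePolynomials_mono {n r s : ℕ} (h : r ≤ s) :
    cubePolynomials n r ≤ cubePolynomials n s :=
  Submodule.span_mono (Set.image_mono fun _ hA => le_trans hA h)

theorem one_mem_cubePolynomials (n r : ℕ) : 1 ∈ cubePolynomials n r :=
  Submodule.subset_span ⟨∅, by simp, by ext; simp [cubeMonomial]⟩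

theorem coord_mul_mem_cubePolynomials {n r : ℕ} (i : Fin n) {p : (Fin n → Bool) → ℝ}
    (hp : p ∈ cubePolynomials n r) :
    (fun x => (if x i then 1 else 0) * p x) ∈ cubePolynomials n (r + 1) := by
  induction hp using Submodule.span_induction with
  | mem p hp =>
    obtain ⟨A, hA, rfl⟩ := hp
    refine Submodule.subset_span ⟨insert i A, ?_, ?_⟩
    · exact (Finset.card_insert_le i A).trans (Nat.succ_le_succ hA)
    · ext x
      by_cases hi : i ∈ A
      · rw [Finset.insert_eq_of_mem hi]
        cases h : x i with
        | true => simp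
        | false =>
          simpa [cubeMonomial] using
            Finset.prod_eq_zero (f := fun i => if x i then (1 : ℝ) else 0) hi (by simp [h])
      · simp only [cubeMonomial]
        rw [Finset.prod_insert hi]
  | zero =>
    convert Submodule.zero_mem (cubePolynomials n (r + 1)) using 1
    ext x
    simp
  | add p q _ _ hp hq =>
    convert Submodule.add_mem _ hp hq using 1
    ext x
    exact mul_add _ _ _
  | smul a p _ hp =>
    convert Submodule.smul_mem _ a hp using 1
    ext x
    exact mul_left_comm _ _ _

theorem literal_mul_mem_cubePolynomials {n r : ℕ} (i : Fin n) (b : Bool)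
    {p : (Fin n → Bool) → ℝ} (hp : p ∈ cubePolynomials n r) :
    (fun x => (if x i = b then 1 else 0) * p x) ∈ cubePolynomials n (r + 1) := by
  cases b with
  | true => exact coord_mul_mem_cubePolynomials i hp
  | false =>
    convert Submodule.sub_mem _ (cubePolynomials_mono (Nat.le_succ r) hp)
      (coord_mul_mem_cubePolynomials i hp) using 1
    ext x
    cases h : x i <;> simp [h]

/-- `p` sign-represents `f`: it is positive where `f` is true and negative where `f` is false. -/
def SignRepresents {X : Type*} (p : X → ℝ) (f : X → Bool) : Prop :=
  ∀ x, 0 < (if f x then 1 else -1) * p x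

/-- If `f` is sign-represented in degree `r` and `g` in degree `r + 1`, then so is, in degree
`r + 1`, the function equal to `f` where `x i = b` and to `g` elsewhere. -/
theorem exists_signRepresents_ite {n r : ℕ} (i : Fin n) (b : Bool)
    {f g : (Fin n → Bool) → Bool} {p q : (Fin n → Bool) → ℝ}
    (hp : p ∈ cubePolynomials n r) (hpf : SignRepresents p f)
    (hq : q ∈ cubePolynomials n (r + 1)) (hqg : SignRepresents q g) :
    ∃ s ∈ cubePolynomials n (r + 1), SignRepresents s fun x => if x i = b then f x else g x := by
  obtain ⟨M, hM⟩ : ∃ M : ℝ, ∀ x, |q x| < M * |p x| := by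
    obtain ⟨M, hM⟩ := (Set.finite_range fun x => |q x| / |p x|).bddAbove
    refine ⟨M + 1, fun x => ?_⟩
    have hpx : 0 < |p x| := abs_pos.mpr fun h => by simpa [h] using hpf x
    rw [← div_lt_iff₀ hpx]
    exact (hM ⟨x, rfl⟩).trans_lt (lt_add_one M)
  refine ⟨_, Submodule.add_mem _
    (Submodule.smul_mem _ M (literal_mul_mem_cubePolynomials i b hp)) hq, fun x => ?_⟩
  by_cases h : x i = b
  · have hMx := hM x
    have hpx := hpf x
    have h₁ := neg_abs_le (q x)
    have h₂ := le_abs_self (q x)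
    cases hf : f x
    · have : p x < 0 := by simpa [hf] using hpx
      rw [abs_of_neg this] at hMx
      simp [h, hf]
      linarith
    · have : 0 < p x := by simpa [hf] using hpx
      rw [abs_of_pos this] at hMx
      simp [h, hf]
      linarith
  · simpa [h] using hqg x

/-- A decision tree of rank at most `r` is a polynomial threshold function of degree `r`. -/
theorem DTree.exists_signRepresents {n : ℕ} (T : DTree n) {r : ℕ} (hT : T.rank ≤ r) :
    ∃ p ∈ cubePolynomials n r, SignRepresents p T.eval := by
  induction T generalizing r with
  | leaf b =>
    refine ⟨_, Submodule.smul_mem _ (if b then 1 else -1) (one_mem_cubePolynomials n r),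
      fun x => ?_⟩
    cases b <;> simp [eval]
  | node i T₀ T₁ ih₀ ih₁ =>
    simp only [rank] at hT
    obtain ⟨s, rfl, h⟩ : ∃ s, r = s + 1 ∧
        (T₀.rank ≤ s ∧ T₁.rank ≤ s + 1 ∨ T₁.rank ≤ s ∧ T₀.rank ≤ s + 1) := by
      refine ⟨r - 1, ?_⟩
      split_ifs at hT <;> omega
    obtain ⟨h₀, h₁⟩ | ⟨h₁, h₀⟩ := h
    · obtain ⟨p, hp, hpf⟩ := ih₀ h₀
      obtain ⟨q, hq, hqg⟩ := ih₁ h₁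
      have heval : (DTree.node i T₀ T₁).eval =
          fun x => if x i = false then T₀.eval x else T₁.eval x := by
        ext x
        cases h : x i <;> simp [eval, h]
      rw [heval]
      exact exists_signRepresents_ite i false hp hpf hq hqg
    · obtain ⟨p, hp, hpf⟩ := ih₁ h₁
      obtain ⟨q, hq, hqg⟩ := ih₀ h₀
      exact exists_signRepresents_ite i true hp hpf hq hqg

/-- A set of points larger than the number of monomials of degree at most `r` carries a nonzero
signed measure annihilating all polynomials of degree at most `r`. -/
theorem exists_annihilator_cubePolynomials {n r : ℕ} {S : Finset (Fin n → Bool)}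
    (hS : (smallSubsets n r).card < S.card) :
    ∃ c : S → ℝ, c ≠ 0 ∧ ∀ p ∈ cubePolynomials n r, ∑ x : S, c x * p x = 0 := by
  let L : (S → ℝ) →ₗ[ℝ] (smallSubsets n r → ℝ) :=
    (Matrix.of fun (A : smallSubsets n r) (x : S) => cubeMonomial A.1 x.1).mulVecLin
  have hL : LinearMap.ker L ≠ ⊥ := LinearMap.ker_ne_bot_of_finrank_lt (by simpa using hS)
  obtain ⟨c, hc, hc0⟩ := Submodule.exists_mem_ne_zero_of_ne_bot hL
  refine ⟨c, hc0, fun p hp => ?_⟩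
  induction hp using Submodule.span_induction with
  | mem p hp =>
    obtain ⟨A, hA, rfl⟩ := hp
    have := congrFun (LinearMap.mem_ker.mp hc) ⟨A, mem_smallSubsets.mpr hA⟩
    simpa [L, Matrix.mulVec, dotProduct, mul_comm] using this
  | zero => simp
  | add p q _ _ hp hq => simp only [Pi.add_apply, mul_add, Finset.sum_add_distrib, hp, hq, add_zero]
  | smul a p _ hp =>
    simp only [Pi.smul_apply, smul_eq_mul, mul_left_comm _ a, ← Finset.mul_sum, hp, mul_zero]

/-- A class of polynomial threshold functions of degree `r` shatters no set larger than the number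
of monomials of degree at most `r`. -/
theorem Shatters.card_le_of_signRepresents {n r : ℕ} {H : Set ((Fin n → Bool) → Bool)}
    {S : Finset (Fin n → Bool)} (hS : Shatters H S)
    (hH : ∀ f ∈ H, ∃ p ∈ cubePolynomials n r, SignRepresents p f) :
    S.card ≤ (smallSubsets n r).card := by
  by_contra! hlt
  obtain ⟨c, hc0, hc⟩ := exists_annihilator_cubePolynomials hlt
  obtain ⟨f, hf, hfg⟩ := hS fun x => if h : x ∈ S then decide (0 < c ⟨x, h⟩) else false
  obtain ⟨p, hp, hpf⟩ := hH f hf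
  have key (x : S) : 0 ≤ c x * p x ∧ (c x * p x = 0 → c x = 0) := by
    have hx : f x = decide (0 < c x) := by simpa using hfg x x.2
    have hpx := hpf x
    rw [hx] at hpx
    by_cases h : 0 < c x
    · have : 0 < p x := by simpa [h] using hpx
      exact ⟨by positivity, fun h0 => (mul_eq_zero.mp h0).resolve_right this.ne'⟩
    · have : p x < 0 := by simpa [h] using hpx
      exact ⟨mul_nonneg_of_nonpos_of_nonpos (not_lt.mp h) this.le,
        fun h0 => (mul_eq_zero.mp h0).resolve_right this.ne⟩
  refine hc0 (funext fun x => (key x).2 ?_)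
  exact (Finset.sum_eq_zero_iff_of_nonneg fun x _ => (key x).1).mp (hc p hp) x (Finset.mem_univ x)

/-- Simon's theorem: the VC-dimension of the class `DT_n^r` of Boolean functions
computable by a decision tree over `n` Boolean variables of rank at most `r`
(querying each variable at most once along each path) equals `∑_{i=0}^r C(n,i)`:
some shattered set attains this cardinality, and every shattered set is at most
this large. -/
theorem vcDim_decision_trees_rank (n r : ℕ) :
    (∃ S : Finset (Fin n → Bool),
        Shatters {f | ∃ T : DTree n, T.ReadOnce ∧ T.rank ≤ r ∧ ∀ x, T.eval x = f x} S ∧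
        S.card = ∑ i ∈ Finset.range (r + 1), n.choose i) ∧
    (∀ S : Finset (Fin n → Bool),
        Shatters {f | ∃ T : DTree n, T.ReadOnce ∧ T.rank ≤ r ∧ ∀ x, T.eval x = f x} S →
        S.card ≤ ∑ i ∈ Finset.range (r + 1), n.choose i) := by
  rw [← card_smallSubsets]
  refine ⟨⟨(smallSubsets n r).image fun A i => decide (i ∈ A), fun g => ?_, ?_⟩, fun S hS => ?_⟩
  · obtain ⟨T, -, hT, hr, he⟩ :=
      DTree.exists_eval_eq_of_card_le g Finset.univ r fun _ => false
    refine ⟨T.eval, ⟨T, hT, hr, fun _ => rfl⟩, fun x hx => he x (by simp) ?_⟩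
    obtain ⟨A, hA, rfl⟩ := Finset.mem_image.mp hx
    simpa using mem_smallSubsets.mp hA
  · refine Finset.card_image_of_injective _ fun A B hAB => ?_
    ext i
    simpa using congrFun hAB i
  · refine hS.card_le_of_signRepresents ?_
    rintro f ⟨T, -, hr, he⟩
    rw [← funext he]
    exact T.exists_signRepresents hr
end

section
/- Let T be a finite binary tree and r ≥ 0. Then rank(T) > r if and only if the complete binary tree of depth r + 1 can be embedded into T, i.e., there is a map φ from the nodes of the complete binary tree B of depth r+1 to the nodes of T such that for every internal node u of B, φ(left child of u) lies in the subtree rooted at the left child of φ(u) and φ(right child of u) lies in the subtree rooted at the right child of φ(u). -/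
/-- A finite binary tree: either a single leaf node, or a root with two subtrees. -/
inductive BTree where
  | leaf
  | node (l r : BTree)

/-- The rank of a binary tree: a single node has rank `0`; a tree with subtrees of
ranks `r₀, r₁` has rank `r₀ + 1` if `r₀ = r₁` and rank `max r₀ r₁` otherwise. -/
def BTree.rank : BTree → ℕ
  | .leaf => 0
  | .node l r => if l.rank = r.rank then l.rank + 1 else max l.rank r.rank

/-- The complete binary tree of depth `m`: every internal node has two children
and every leaf is at distance exactly `m` from the root. -/
def BTree.complete : ℕ → BTree
  | 0 => .leaf
  | m + 1 => .node (complete m) (complete m)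

/-- `Embeds B T`: the binary tree `B` can be embedded into the binary tree `T`,
i.e. there is a map `φ` from the nodes of `B` to the nodes of `T` such that for
every internal node `u` of `B`, `φ(left child of u)` lies in the subtree rooted at
the left child of `φ(u)` and `φ(right child of u)` lies in the subtree rooted at
the right child of `φ(u)`. Rendered inductively: a single node embeds into any
tree (its root may map to any node); `node B₀ B₁` embeds into `T` with the root
mapped to the root of `T = node T₀ T₁` whenever `B₀` embeds into `T₀` and `B₁`
embeds into `T₁`; and any embedding may map the root of `B` strictly inside the
left or right subtree of `T`. -/
inductive BTree.Embeds : BTree → BTree → Prop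
  | leaf (T : BTree) : Embeds .leaf T
  | node {B₀ B₁ T₀ T₁ : BTree} :
      Embeds B₀ T₀ → Embeds B₁ T₁ → Embeds (.node B₀ B₁) (.node T₀ T₁)
  | left {B T₀ T₁ : BTree} : Embeds B T₀ → Embeds B (.node T₀ T₁)
  | right {B T₀ T₁ : BTree} : Embeds B T₁ → Embeds B (.node T₀ T₁)

theorem BTree.rank_complete (m : ℕ) : (BTree.complete m).rank = m := by
  induction m with
  | zero => rfl
  | succ m ih => simp [BTree.complete, BTree.rank, ih]

theorem BTree.Embeds.rank_le {B T : BTree} (h : BTree.Embeds B T) : B.rank ≤ T.rank := by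
  induction h with
  | leaf T => exact Nat.zero_le _
  | node _ _ ih₀ ih₁ => simp only [BTree.rank]; split_ifs <;> omega
  | left _ ih => simp only [BTree.rank]; split_ifs <;> omega
  | right _ ih => simp only [BTree.rank]; split_ifs <;> omega

theorem BTree.complete_embeds_of_le_rank {m : ℕ} {T : BTree} (h : m ≤ T.rank) :
    BTree.Embeds (BTree.complete m) T := by
  induction T generalizing m with
  | leaf =>
    obtain rfl : m = 0 := Nat.le_zero.mp h
    exact .leaf _
  | node l r ihl ihr =>
    by_cases hl : m ≤ l.rank
    · exact .left (ihl hl)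
    by_cases hr : m ≤ r.rank
    · exact .right (ihr hr)
    cases m with
    | zero => exact .leaf _
    | succ k =>
      simp only [BTree.rank] at h
      split_ifs at h with heq
      · exact .node (ihl (by omega)) (ihr (by omega))
      · omega

/-- For a finite binary tree `T` and `r ≥ 0`, `rank T > r` if and only if the
complete binary tree of depth `r + 1` can be embedded into `T`. -/
theorem rank_gt_iff_complete_embeds (T : BTree) (r : ℕ) :
    r < T.rank ↔ BTree.Embeds (BTree.complete (r + 1)) T := by
  refine ⟨BTree.complete_embeds_of_le_rank, fun h => ?_⟩
  simpa [BTree.rank_complete] using h.rank_le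
end
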